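/- arXiv:2403.08421 — 6 statements merged into one kernel-verified Lean document; each statement's English description precedes it below -/
import Mathlib

section
/- An indicator R satisfies composition and non-manipulability if and only if R is the subscriber-proportional indicator, i.e., R_i(N,S,p,C) = Σ_{s∈S} (C_{is} / Σ_{j∈N} C_{js}) · p_s for every platform (N,S,p,C) and every i ∈ N. -/
open Finset

/-- A streaming platform: a finite set `N` of services (`|N| ≥ 3`), a finite nonempty set `S`
of subscribers, positive subscription prices `p` on `S`, and a nonnegative consumption matrix
`C` whose columns (over `N`) have positive sum. -/
structure Platform where
  N : Finset ℕ
  S : Finset ℕ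
  p : ℕ → ℝ
  C : ℕ → ℕ → ℝ
  card_N : 3 ≤ N.card
  S_nonempty : S.Nonempty
  p_pos : ∀ s ∈ S, 0 < p s
  C_nonneg : ∀ i s, 0 ≤ C i s
  col_pos : ∀ s ∈ S, 0 < ∑ i ∈ N, C i s

/-- The success of the platform: total subscription revenue. -/
noncomputable def success (P : Platform) : ℝ := ∑ s ∈ P.S, P.p s

/-- `Ns P s` is the set of services consumed by subscriber `s`. -/
noncomputable def Ns (P : Platform) (s : ℕ) : Finset ℕ :=
  P.N.filter fun j => 0 < P.C j s

/-- The uniform indicator. -/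
noncomputable def RU (P : Platform) (_ : ℕ) : ℝ := success P / (P.N.card : ℝ)

/-- The subscriber-uniform indicator. -/
noncomputable def RSU (P : Platform) (i : ℕ) : ℝ :=
  ∑ s ∈ P.S.filter (fun s => i ∈ Ns P s), P.p s / ((Ns P s).card : ℝ)

/-- The proportional indicator. -/
noncomputable def RP (P : Platform) (i : ℕ) : ℝ :=
  ((∑ s ∈ P.S, P.C i s) / ∑ j ∈ P.N, ∑ s ∈ P.S, P.C j s) * success P

/-- The subscriber-proportional indicator. -/
noncomputable def RSP (P : Platform) (i : ℕ) : ℝ :=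
  ∑ s ∈ P.S, (P.C i s / ∑ j ∈ P.N, P.C j s) * P.p s

/-- An indicator assigns to each platform a vector of nonnegative reals on `N`
summing to the success of the platform. -/
def IsIndicator (R : Platform → ℕ → ℝ) : Prop :=
  ∀ P : Platform, (∀ i ∈ P.N, 0 ≤ R P i) ∧ (∑ i ∈ P.N, R P i = success P)

/-- CompositionAxiom: combining two disjoint subscriber populations adds the indicators. -/
def CompositionAxiom (R : Platform → ℕ → ℝ) : Prop :=
  ∀ P P' Q : Platform,
    P'.N = P.N → Q.N = P.N →
    Disjoint P.S P'.S →
    Q.S = P.S ∪ P'.S →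
    (∀ s ∈ P.S, Q.p s = P.p s) → (∀ s ∈ P'.S, Q.p s = P'.p s) →
    (∀ i ∈ P.N, ∀ s ∈ P.S, Q.C i s = P.C i s) →
    (∀ i ∈ P.N, ∀ s ∈ P'.S, Q.C i s = P'.C i s) →
    ∀ i ∈ P.N, R Q i = R P i + R P' i

/-- Non-manipulability: merging a group of services `N'` into a single service `i`
gives that service the total relevance of the group. -/
def NonManipulability (R : Platform → ℕ → ℝ) : Prop :=
  ∀ P Q : Platform, ∀ N' ⊆ P.N, N'.Nonempty → ∀ i ∈ N',
    Q.N = insert i (P.N \ N') →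
    Q.S = P.S →
    (∀ s ∈ P.S, Q.p s = P.p s) →
    (∀ s ∈ P.S, Q.C i s = ∑ j ∈ N', P.C j s) →
    (∀ j ∈ P.N \ N', ∀ s ∈ P.S, Q.C j s = P.C j s) →
    R Q i = ∑ j ∈ N', R P j

/-- Sharing proofness: merging a group of subscribers `S'` into a single subscriber `s`
(adding their prices and consumptions) leaves the indicator unchanged. -/
def SharingProofness (R : Platform → ℕ → ℝ) : Prop :=
  ∀ P Q : Platform, ∀ S' ⊆ P.S, S'.Nonempty → ∀ s ∈ S',
    Q.N = P.N →
    Q.S = insert s (P.S \ S') →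
    Q.p s = ∑ t ∈ S', P.p t →
    (∀ t ∈ P.S \ S', Q.p t = P.p t) →
    (∀ i ∈ P.N, Q.C i s = ∑ t ∈ S', P.C i t) →
    (∀ i ∈ P.N, ∀ t ∈ P.S \ S', Q.C i t = P.C i t) →
    ∀ i ∈ P.N, R Q i = R P i

/-- Symmetry: services with identical consumption get the same relevance. -/
def Symmetry (R : Platform → ℕ → ℝ) : Prop :=
  ∀ P : Platform, ∀ i ∈ P.N, ∀ j ∈ P.N,
    (∀ s ∈ P.S, P.C i s = P.C j s) → R P i = R P j

/-- Strong symmetry: services consumed by exactly the same subscribers get the same relevance. -/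
def StrongSymmetry (R : Platform → ℕ → ℝ) : Prop :=
  ∀ P : Platform, ∀ i ∈ P.N, ∀ j ∈ P.N,
    (∀ s ∈ P.S, 0 < P.C i s ↔ 0 < P.C j s) → R P i = R P j

/-- Nullity: a service consumed by nobody gets zero relevance. -/
def Nullity (R : Platform → ℕ → ℝ) : Prop :=
  ∀ P : Platform, ∀ i ∈ P.N, (∀ s ∈ P.S, P.C i s = 0) → R P i = 0

/-- Homogeneity: rescaling the consumption matrix by a positive constant leaves the
indicator unchanged. -/
def Homogeneity (R : Platform → ℕ → ℝ) : Prop :=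
  ∀ P Q : Platform, ∀ lam : ℝ, 0 < lam →
    Q.N = P.N → Q.S = P.S →
    (∀ s ∈ P.S, Q.p s = P.p s) →
    (∀ i ∈ P.N, ∀ s ∈ P.S, Q.C i s = lam * P.C i s) →
    ∀ i ∈ P.N, R Q i = R P i

/-- Consumption sensitivity: for fixed `N`, `S`, `p`, if two sequences of admissible
consumption matrices become arbitrarily close (in ℓ¹), so do the corresponding indicators. -/
def ConsumptionSensitivity (R : Platform → ℕ → ℝ) : Prop :=
  ∀ (P Q : ℕ → Platform) (N S : Finset ℕ) (p : ℕ → ℝ),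
    (∀ n, (P n).N = N) → (∀ n, (Q n).N = N) →
    (∀ n, (P n).S = S) → (∀ n, (Q n).S = S) →
    (∀ n, ∀ s ∈ S, (P n).p s = p s) → (∀ n, ∀ s ∈ S, (Q n).p s = p s) →
    Filter.Tendsto (fun n => ∑ i ∈ N, ∑ s ∈ S, |(P n).C i s - (Q n).C i s|)
      Filter.atTop (nhds 0) →
    Filter.Tendsto (fun n => ∑ i ∈ N, |R (P n) i - R (Q n) i|)
      Filter.atTop (nhds 0)

/-- Replace entry `(i, s)` of the matrix `C` by `x`. -/
noncomputable def upd (C : ℕ → ℕ → ℝ) (i s : ℕ) (x : ℝ) : ℕ → ℕ → ℝ :=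
  fun j t => if j = i ∧ t = s then x else C j t

/-- A nonnegative function that is additive on `[0, t]` is linear there. -/
lemma eq_mul_div_of_additive_on_Icc {g : ℝ → ℝ} {t : ℝ} (ht : 0 < t)
    (hg : ∀ x, 0 ≤ x → x ≤ t → 0 ≤ g x)
    (hadd : ∀ x y, 0 ≤ x → 0 ≤ y → x + y ≤ t → g (x + y) = g x + g y)
    {x : ℝ} (hx : 0 ≤ x) (hxt : x ≤ t) : g x = g t * x / t := by
  have h0 : g 0 = 0 := by
    have := hadd 0 0 le_rfl le_rfl (by simpa using ht.le)
    simp only [add_zero] at this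
    linarith
  have hmono : ∀ a b, 0 ≤ a → a ≤ b → b ≤ t → g a ≤ g b := by
    intro a b ha hab hb
    have h1 := hadd a (b - a) ha (by linarith) (by linarith)
    have h2 := hg (b - a) (by linarith) (by linarith)
    rw [add_sub_cancel] at h1
    linarith
  have hmul : ∀ (n : ℕ) (y : ℝ), 0 ≤ y → n * y ≤ t → g (n * y) = n * g y := by
    intro n y hy
    induction n with
    | zero => simp [h0]
    | succ n ih =>
      intro h
      push_cast at h ⊢
      have hn : (0 : ℝ) ≤ n * y := by positivity
      rw [add_mul, one_mul, hadd _ _ hn hy (by linarith), ih (by linarith)]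
      ring
  have hgt : 0 ≤ g t := hg t ht.le le_rfl
  have hfrac : ∀ n m : ℕ, 0 < n → m ≤ n → g (m * (t / n)) = m * (g t / n) := by
    intro n m hn hmn
    have hn' : (0 : ℝ) < n := by exact_mod_cast hn
    have hmn' : (m : ℝ) ≤ n := by exact_mod_cast hmn
    have h1 := hmul n (t / n) (by positivity) (by rw [mul_div_cancel₀ _ hn'.ne'])
    rw [mul_div_cancel₀ _ hn'.ne'] at h1
    have h2 : m * (t / n) ≤ t := by
      calc m * (t / n) ≤ n * (t / n) := by gcongr
        _ = t := mul_div_cancel₀ _ hn'.ne'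
    rw [hmul m _ (by positivity) h2, h1, mul_div_cancel_left₀ _ hn'.ne']
  rcases hxt.eq_or_lt with rfl | hlt
  · rw [mul_div_cancel_right₀ _ ht.ne']
  have key : ∀ n : ℕ, 0 < n → |g x - g t * x / t| ≤ g t / n := by
    intro n hn
    have hn' : (0 : ℝ) < n := by exact_mod_cast hn
    set m := ⌊n * x / t⌋₊
    have hm1 : (m : ℝ) ≤ n * x / t := Nat.floor_le (by positivity)
    have hm2 : n * x / t < m + 1 := Nat.lt_floor_add_one _
    have hmn : m + 1 ≤ n := by
      have : (m : ℝ) < n := hm1.trans_lt (by rw [div_lt_iff₀ ht]; gcongr)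
      exact_mod_cast this
    have hl : m * (t / n) ≤ x := by
      rw [le_div_iff₀ ht] at hm1
      rw [mul_div_assoc', div_le_iff₀ hn']
      linarith
    have hu : x ≤ ((m + 1 : ℕ) : ℝ) * (t / n) := by
      rw [div_lt_iff₀ ht] at hm2
      push_cast
      rw [mul_div_assoc', le_div_iff₀ hn']
      linarith
    have hut : ((m + 1 : ℕ) : ℝ) * (t / n) ≤ t := by
      have : ((m + 1 : ℕ) : ℝ) ≤ n := by exact_mod_cast hmn
      calc ((m + 1 : ℕ) : ℝ) * (t / n) ≤ n * (t / n) := by gcongr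
        _ = t := mul_div_cancel₀ _ hn'.ne'
    have h1 := hmono _ _ (by positivity) hl hxt
    have h2 := hmono _ _ hx hu hut
    rw [hfrac n m hn (by omega)] at h1
    rw [hfrac n (m + 1) hn hmn] at h2
    push_cast at h2
    have h3 : m * (g t / n) ≤ g t * x / t := by
      calc m * (g t / n) ≤ (n * x / t) * (g t / n) := by gcongr
        _ = g t * x / t := by field_simp
    have h4 : g t * x / t ≤ (m + 1) * (g t / n) := by
      calc g t * x / t = (n * x / t) * (g t / n) := by field_simp
        _ ≤ (m + 1) * (g t / n) := by gcongr
    rw [abs_le]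
    constructor <;> linarith
  by_contra hne
  have hpos : 0 < |g x - g t * x / t| := abs_pos.mpr (sub_ne_zero.mpr hne)
  obtain ⟨n, hn⟩ := exists_nat_gt (g t / |g x - g t * x / t|)
  have hn0 : (0 : ℝ) < n := (div_nonneg hgt hpos.le).trans_lt hn
  have h := key n (by exact_mod_cast hn0)
  rw [div_lt_iff₀ hpos] at hn
  rw [le_div_iff₀ hn0] at h
  linarith

/-- An admissible consumption vector of a single subscriber. -/
def Admissible (N : Finset ℕ) (c : ℕ → ℝ) : Prop :=
  3 ≤ N.card ∧ (∀ i, 0 ≤ c i) ∧ 0 < ∑ i ∈ N, c i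

/-- A rule sharing a fixed amount `q` among the services consumed by one subscriber, such that
the share of a merged service is the sum of the shares of its parts. -/
structure IsMergeable (f : Finset ℕ → (ℕ → ℝ) → ℕ → ℝ) (q : ℝ) : Prop where
  nonneg : ∀ {N c}, Admissible N c → ∀ i ∈ N, 0 ≤ f N c i
  sum_eq : ∀ {N c}, Admissible N c → ∑ i ∈ N, f N c i = q
  merge : ∀ {N c d T i}, Admissible N c → Admissible (insert i (N \ T)) d → T ⊆ N → i ∈ T →
    d i = ∑ j ∈ T, c j → (∀ j ∈ N \ T, d j = c j) →
    f (insert i (N \ T)) d i = ∑ j ∈ T, f N c j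

namespace IsMergeable

variable {f : Finset ℕ → (ℕ → ℝ) → ℕ → ℝ} {q : ℝ}

/-- The total share of a group depends only on its total consumption and on the consumption
outside the group. -/
lemma sum_congr_group (hf : IsMergeable f q) {M T : Finset ℕ} {c c' : ℕ → ℝ}
    (hc : Admissible M c) (hc' : Admissible M c') (hT : T ⊆ M) (hne : T.Nonempty)
    (hcard : 2 ≤ (M \ T).card) (hout : ∀ j ∈ M \ T, c j = c' j)
    (hsum : ∑ j ∈ T, c j = ∑ j ∈ T, c' j) : ∑ j ∈ T, f M c j = ∑ j ∈ T, f M c' j := by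
  obtain ⟨i, hi⟩ := hne
  have hi' : i ∉ M \ T := by simp [hi]
  set d := Function.update c i (∑ j ∈ T, c j) with hd
  have hdi : d i = ∑ j ∈ T, c j := by simp [hd]
  have hdj : ∀ j ∈ M \ T, d j = c j := fun j hj =>
    Function.update_of_ne (by rintro rfl; exact hi' hj) _ _
  have hadm : Admissible (insert i (M \ T)) d := by
    refine ⟨by rw [card_insert_of_notMem hi']; omega, fun j => ?_, ?_⟩
    · rw [hd, Function.update_apply]
      split_ifs
      · exact sum_nonneg fun _ _ => hc.2.1 _
      · exact hc.2.1 j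
    · rw [sum_insert hi', hdi, sum_congr rfl hdj, add_comm, sum_sdiff hT]
      exact hc.2.2
  rw [← hf.merge hc hadm hT hi hdi hdj,
    ← hf.merge hc' hadm hT hi (hdi.trans hsum) fun j hj => (hdj j hj).trans (hout j hj)]

/-- Adding a service that is not consumed does not change the share of a service, and the new
service gets nothing. -/
lemma insert_null (hf : IsMergeable f q) {N : Finset ℕ} {c : ℕ → ℝ} {l : ℕ}
    (hc : Admissible N c) (hl : l ∉ N) (hcl : c l = 0) :
    f (insert l N) c l = 0 ∧ ∀ i ∈ N, f N c i = f (insert l N) c i := by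
  have hM : Admissible (insert l N) c :=
    ⟨by rw [card_insert_of_notMem hl]; have := hc.1; omega, hc.2.1, by
      rw [sum_insert hl, hcl, zero_add]; exact hc.2.2⟩
  have h1 : ∀ i ∈ N, f N c i = f (insert l N) c i + f (insert l N) c l := by
    intro i hi
    have hil : i ≠ l := fun h => hl (h ▸ hi)
    have hN : insert i (insert l N \ {i, l}) = N := by
      ext j
      simp only [mem_insert, mem_sdiff, mem_singleton]
      by_cases hji : j = i
      · simp [hji, hi]
      · by_cases hjl : j = l
        · simp [hjl, hl, hil.symm]
        · simp [hji, hjl]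
    have := hf.merge (T := {i, l}) (i := i) hM (by rw [hN]; exact hc)
      (by intro j; simp only [mem_insert, mem_singleton]; rintro (rfl | rfl) <;> simp [hi])
      (by simp) (by rw [sum_pair hil, hcl, add_zero]) (fun _ _ => rfl)
    rwa [hN, sum_pair hil] at this
  have h2 := hf.sum_eq hM
  rw [sum_insert hl, ← hf.sum_eq hc, sum_congr rfl h1, sum_add_distrib, sum_const,
    nsmul_eq_mul] at h2
  have h3 : (3 : ℝ) ≤ N.card := by exact_mod_cast hc.1
  have h4 : f (insert l N) c l = 0 := by
    have : ((N.card : ℝ) - 1) * f (insert l N) c l = 0 := by linarith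
    rcases mul_eq_zero.mp this with h | h
    · linarith
    · exact h
  exact ⟨h4, fun i hi => by rw [h1 i hi, h4, add_zero]⟩

/-- A service that is not consumed gets nothing. -/
lemma eq_zero_of_null (hf : IsMergeable f q) {N : Finset ℕ} {c : ℕ → ℝ} {i : ℕ}
    (hc : Admissible N c) (hi : i ∈ N) (hci : c i = 0) (hcard : 4 ≤ N.card) : f N c i = 0 := by
  have h := hf.insert_null (N := N.erase i) (c := c) (l := i)
    ⟨by rw [card_erase_of_mem hi]; omega, hc.2.1, by
      have := hc.2.2
      rwa [← add_sum_erase _ _ hi, hci, zero_add] at this⟩ (notMem_erase _ _) hci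
  rw [insert_erase hi] at h
  exact h.1

/-- In the presence of a null service, the share of a service depends only on its own
consumption and on the total consumption. -/
lemma eq_of_null (hf : IsMergeable f q) {M : Finset ℕ} {c c' : ℕ → ℝ} {i l : ℕ}
    (hM : 4 ≤ M.card) (hc : Admissible M c) (hc' : Admissible M c') (hi : i ∈ M) (hl : l ∈ M)
    (hil : i ≠ l) (hcl : c l = 0) (hcl' : c' l = 0) (hci : c i = c' i)
    (hsum : ∑ j ∈ M, c j = ∑ j ∈ M, c' j) : f M c i = f M c' i := by
  have hsub : ({i, l} : Finset ℕ) ⊆ M := by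
    intro j; simp only [mem_insert, mem_singleton]; rintro (rfl | rfl) <;> assumption
  have hcard : (M \ {i, l}).card = M.card - 2 := by
    rw [card_sdiff_of_subset hsub, card_pair hil]
  have hpair : ∀ g : ℕ → ℝ, ∑ j ∈ M, g j = ∑ j ∈ M \ {i, l}, g j + (g i + g l) := fun g => by
    rw [← sum_pair hil, sum_sdiff hsub]
  have h := hf.sum_congr_group hc hc' (sdiff_subset (s := M) (t := {i, l}))
    (card_pos.mp (by omega)) (by rw [Finset.sdiff_sdiff_eq_self hsub, card_pair hil])
    (by
      rw [Finset.sdiff_sdiff_eq_self hsub]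
      intro j; simp only [mem_insert, mem_singleton]; rintro (rfl | rfl)
      exacts [hci, hcl.trans hcl'.symm])
    (by
      rw [hpair c, hpair c'] at hsum
      linarith)
  have h1 := hpair (f M c)
  have h2 := hpair (f M c')
  rw [hf.sum_eq hc, hf.eq_zero_of_null hc hl hcl hM] at h1
  rw [hf.sum_eq hc', hf.eq_zero_of_null hc' hl hcl' hM] at h2
  linarith

/-- Mergeable rules share proportionally to consumption. -/
theorem eq_proportional (hf : IsMergeable f q) {N : Finset ℕ} {c : ℕ → ℝ}
    (hc : Admissible N c) {i : ℕ} (hi : i ∈ N) : f N c i = c i / (∑ j ∈ N, c j) * q := by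
  obtain ⟨l, hl⟩ := Infinite.exists_notMem_finset N
  set t := ∑ j ∈ N, c j with ht
  have ht0 : 0 < t := hc.2.2
  set M := insert l N with hM
  have hMcard : 4 ≤ M.card := by rw [hM, card_insert_of_notMem hl]; have := hc.1; omega
  have hNM : ∀ j ∈ N, j ∈ M := fun j hj => mem_insert_of_mem hj
  have hlM : l ∈ M := mem_insert_self _ _
  have hne : ∀ j ∈ N, j ≠ l := fun j hj h => hl (h ▸ hj)
  obtain ⟨j, hj, hji⟩ : ∃ j ∈ N, j ≠ i := exists_mem_ne (by have := hc.1; omega) i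
  obtain ⟨k, hk, hki, hkj⟩ : ∃ k ∈ N, k ≠ i ∧ k ≠ j := by
    have : 0 < (N \ {i, j}).card := by
      have h1 := le_card_sdiff {i, j} N
      have h2 := card_le_two (a := i) (b := j)
      have := hc.1
      omega
    obtain ⟨k, hk⟩ := card_pos.mp this
    simp only [mem_sdiff, mem_insert, mem_singleton, not_or] at hk
    exact ⟨k, hk.1, hk.2.1, hk.2.2⟩
  let v : ℝ → ℝ → ℕ → ℝ := fun x y => Pi.single i x + Pi.single j y + Pi.single k (t - x - y)
  have hvi : ∀ x y, v x y i = x := fun x y => by simp [v, hji.symm, hki.symm]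
  have hvj : ∀ x y, v x y j = y := fun x y => by simp [v, hji, hkj.symm]
  have hvl : ∀ x y, v x y l = 0 := fun x y => by
    simp [v, (hne _ hi).symm, (hne _ hj).symm, (hne _ hk).symm]
  have hvsum : ∀ x y, ∑ m ∈ M, v x y m = t := fun x y => by
    simp [v, sum_add_distrib, hNM _ hi, hNM _ hj, hNM _ hk]
  have hv : ∀ x y, 0 ≤ x → 0 ≤ y → x + y ≤ t → Admissible M (v x y) := by
    intro x y hx hy hxy
    refine ⟨by omega, fun m => ?_, by rw [hvsum]; exact ht0⟩
    simp only [v, Pi.add_apply, Pi.single_apply]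
    have : 0 ≤ t - x - y := by linarith
    split_ifs <;> linarith
  have hcong : ∀ x y z w, 0 ≤ x → 0 ≤ y → x + y ≤ t → 0 ≤ z → 0 ≤ w → z + w ≤ t →
      (x = z → f M (v x y) i = f M (v z w) i) ∧ (y = w → f M (v x y) j = f M (v z w) j) := by
    intro x y z w hx hy hxy hz hw hzw
    exact ⟨fun h => hf.eq_of_null hMcard (hv _ _ hx hy hxy) (hv _ _ hz hw hzw) (hNM _ hi) hlM
        (hne _ hi) (hvl _ _) (hvl _ _) (by rw [hvi, hvi, h]) (by rw [hvsum, hvsum]),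
      fun h => hf.eq_of_null hMcard (hv _ _ hx hy hxy) (hv _ _ hz hw hzw) (hNM _ hj) hlM
        (hne _ hj) (hvl _ _) (hvl _ _) (by rw [hvj, hvj, h]) (by rw [hvsum, hvsum])⟩
  have hmove : ∀ x y, 0 ≤ x → 0 ≤ y → x + y ≤ t →
      f M (v x y) i + f M (v x y) j = f M (v (x + y) 0) i := by
    intro x y hx hy hxy
    have hsub : ({i, j} : Finset ℕ) ⊆ M := by
      intro m; simp only [mem_insert, mem_singleton]
      rintro (rfl | rfl)
      exacts [hNM _ hi, hNM _ hj]
    have hv' := hv (x + y) 0 (by linarith) le_rfl (by linarith)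
    have h := hf.sum_congr_group (T := {i, j}) (hv x y hx hy hxy) hv' hsub (by simp)
      (by rw [card_sdiff_of_subset hsub, card_pair hji.symm]; omega)
      (by
        intro m hm
        simp only [mem_sdiff, mem_insert, mem_singleton, not_or] at hm
        simp [v, Pi.single_apply, hm.2.1, hm.2.2, sub_sub])
      (by rw [sum_pair hji.symm, sum_pair hji.symm, hvi, hvj, hvi, hvj, add_zero])
    rwa [sum_pair hji.symm, sum_pair hji.symm,
      hf.eq_zero_of_null hv' (hNM _ hj) (hvj _ _) hMcard, add_zero] at h
  set g : ℝ → ℝ := fun x => f M (v x 0) i with hg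
  have hgt : g t = q := by
    have hadm := hv t 0 ht0.le le_rfl (by simp)
    rw [← hf.sum_eq hadm, sum_eq_single_of_mem i (hNM _ hi)]
    intro m hm hmi
    exact hf.eq_zero_of_null hadm hm (by simp [v, Pi.single_apply, hmi]) hMcard
  have hadd : ∀ x y, 0 ≤ x → 0 ≤ y → x + y ≤ t → g (x + y) = g x + g y := by
    intro x y hx hy hxy
    have h1 := hmove x y hx hy hxy
    have h2 := hmove 0 y le_rfl hy (by linarith)
    rw [hf.eq_zero_of_null (hv 0 y le_rfl hy (by linarith)) (hNM _ hi) (hvi _ _) hMcard,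
      zero_add, zero_add] at h2
    have h3 := (hcong x y x 0 hx hy hxy hx le_rfl (by linarith)).1 rfl
    have h4 := (hcong x y 0 y hx hy hxy le_rfl hy (by linarith)).2 rfl
    simp only [hg]
    rw [← h1, ← h2, h3, h4]
  have hlin := eq_mul_div_of_additive_on_Icc (g := g) ht0
    (fun x hx hxt => hf.nonneg (hv x 0 hx le_rfl (by simpa using hxt)) i (hNM _ hi)) hadd
    (hc.2.1 i) (single_le_sum (fun m _ => hc.2.1 m) hi)
  -- Extend `c` by zero at the new service.
  set d := Function.update c l 0 with hd
  have hdl : d l = 0 := by simp [hd]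
  have hdN : ∀ m ∈ N, d m = c m := fun m hm => Function.update_of_ne (hne m hm) _ _
  have hdsum : ∑ m ∈ N, d m = t := sum_congr rfl hdN
  have hd0 : ∀ m, 0 ≤ d m := fun m => by
    rw [hd, Function.update_apply]
    split_ifs
    exacts [le_rfl, hc.2.1 m]
  have hdadm : Admissible N d := ⟨hc.1, hd0, by rw [hdsum]; exact ht0⟩
  have hdM : ∑ m ∈ M, d m = t := by rw [hM, sum_insert hl, hdl, zero_add, hdsum]
  have hdadmM : Admissible M d := ⟨by omega, hd0, by rw [hdM]; exact ht0⟩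
  have hci : c i ≤ t := single_le_sum (fun m _ => hc.2.1 m) hi
  have hN : insert i (N \ {i}) = N := by
    rw [sdiff_singleton_eq_erase, insert_erase hi]
  have h1 : f N d i = f N c i := by
    have := hf.merge (T := {i}) (i := i) (d := d) hc (by rwa [hN]) (by simpa using hi)
      (by simp) (by rw [sum_singleton, hdN i hi])
      (fun m hm => hdN m (mem_sdiff.mp hm).1)
    rwa [hN, sum_singleton] at this
  have h2 := (hf.insert_null hdadm hl hdl).2 i hi
  have h3 : f M d i = g (c i) :=
    hf.eq_of_null hMcard hdadmM (hv _ 0 (hc.2.1 i) le_rfl (by simpa using hci)) (hNM _ hi) hlM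
      (hne _ hi) hdl (hvl _ _) (by rw [hvi, hdN i hi]) (by rw [hvsum, hdM])
  rw [← h1, h2, h3, hlin, hgt]
  ring

end IsMergeable

/-- The platform with one subscriber `s`, who pays `q` and has consumption vector `c`. -/
def singleSubscriber (s : ℕ) {q : ℝ} (hq : 0 < q) {N : Finset ℕ} {c : ℕ → ℝ}
    (hc : Admissible N c) : Platform where
  N := N
  S := {s}
  p := fun _ => q
  C := fun i _ => c i
  card_N := hc.1
  S_nonempty := singleton_nonempty s
  p_pos := fun _ _ => hq
  C_nonneg := fun i _ => hc.2.1 i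
  col_pos := fun _ _ => hc.2.2

/-- The platform restricted to a nonempty set of its subscribers. -/
def Platform.restrict (P : Platform) (S : Finset ℕ) (hne : S.Nonempty) (hS : S ⊆ P.S) :
    Platform where
  N := P.N
  S := S
  p := P.p
  C := P.C
  card_N := P.card_N
  S_nonempty := hne
  p_pos := fun s hs => P.p_pos s (hS hs)
  C_nonneg := P.C_nonneg
  col_pos := fun s hs => P.col_pos s (hS hs)

/-- A non-manipulable indicator depends only on the data indexed by services and subscribers. -/
lemma NonManipulability.congr {R : Platform → ℕ → ℝ} (h : NonManipulability R) {P Q : Platform}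
    (hN : Q.N = P.N) (hS : Q.S = P.S) (hp : ∀ s ∈ P.S, Q.p s = P.p s)
    (hC : ∀ i ∈ P.N, ∀ s ∈ P.S, Q.C i s = P.C i s) {i : ℕ} (hi : i ∈ P.N) :
    R Q i = R P i := by
  have := h P Q {i} (by simpa using hi) (by simp) i (by simp)
    (by rw [sdiff_singleton_eq_erase, insert_erase hi, hN]) hS hp
    (fun s hs => by rw [sum_singleton, hC i hi s hs])
    (fun j hj s hs => hC j (mem_sdiff.mp hj).1 s hs)
  rwa [sum_singleton] at this

open Classical in
lemma NonManipulability.isMergeable {R : Platform → ℕ → ℝ} (hR : IsIndicator R)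
    (h : NonManipulability R) (s : ℕ) {q : ℝ} (hq : 0 < q) :
    IsMergeable
      (fun N c i => if hc : Admissible N c then R (singleSubscriber s hq hc) i else 0) q where
  nonneg := fun hc i hi => by
    rw [dif_pos hc]
    exact (hR (singleSubscriber s hq hc)).1 i hi
  sum_eq := fun hc => by
    simp only [dif_pos hc]
    exact (hR (singleSubscriber s hq hc)).2.trans (sum_singleton _ _)
  merge := fun {N c d T i} hc hd hT hi hdi hdj => by
    simp only [dif_pos hc, dif_pos hd]
    exact h (singleSubscriber s hq hc) (singleSubscriber s hq hd) T hT ⟨i, hi⟩ i hi rfl rfl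
      (fun _ _ => rfl) (fun _ _ => hdi) (fun j hj _ _ => hdj j hj)

/-- With one subscriber, a non-manipulable indicator is proportional to consumption. -/
lemma NonManipulability.eq_RSP_of_singleton {R : Platform → ℕ → ℝ} (hR : IsIndicator R)
    (h : NonManipulability R) {P : Platform} {s : ℕ} (hS : P.S = {s}) {i : ℕ} (hi : i ∈ P.N) :
    R P i = RSP P i := by
  have hs : s ∈ P.S := by simp [hS]
  have hc : Admissible P.N fun j => P.C j s :=
    ⟨P.card_N, fun j => P.C_nonneg j s, P.col_pos s hs⟩
  have h1 := (h.isMergeable hR s (P.p_pos s hs)).eq_proportional hc hi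
  rw [dif_pos hc] at h1
  have h2 : R (singleSubscriber s (P.p_pos s hs) hc) i = R P i :=
    NonManipulability.congr (P := P) (Q := singleSubscriber s (P.p_pos s hs) hc) h rfl hS.symm
      (fun u hu => by rw [hS, mem_singleton] at hu; rw [hu]; rfl)
      (fun j _ u hu => by rw [hS, mem_singleton] at hu; rw [hu]; rfl) hi
  rw [← h2, h1, RSP, hS, sum_singleton]

lemma eq_RSP_of_composition_of_nonManipulability {R : Platform → ℕ → ℝ} (hR : IsIndicator R)
    (hcomp : CompositionAxiom R) (hnm : NonManipulability R) (P : Platform) {i : ℕ}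
    (hi : i ∈ P.N) : R P i = RSP P i := by
  have key : ∀ (S : Finset ℕ) (hne : S.Nonempty) (hS : S ⊆ P.S),
      R (P.restrict S hne hS) i = RSP (P.restrict S hne hS) i := by
    intro S hne
    induction hne using Finset.Nonempty.cons_induction with
    | singleton s =>
      exact fun hS => NonManipulability.eq_RSP_of_singleton hR hnm
        (P := P.restrict {s} (singleton_nonempty s) hS) rfl hi
    | cons s S hs hne ih =>
      intro hS
      have hsP : {s} ⊆ P.S := by simpa using hS (mem_cons_self s S)
      have hSP : S ⊆ P.S := (subset_cons hs).trans hS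
      rw [hcomp (P.restrict {s} (singleton_nonempty s) hsP) (P.restrict S hne hSP)
        (P.restrict (cons s S hs) (cons_nonempty hs) hS) rfl rfl
        (disjoint_singleton_left.mpr hs) (cons_eq_insert s S hs)
        (fun _ _ => rfl) (fun _ _ => rfl) (fun _ _ _ _ => rfl) (fun _ _ _ _ => rfl) i hi,
        ih hSP, NonManipulability.eq_RSP_of_singleton hR hnm
          (P := P.restrict {s} (singleton_nonempty s) hsP) rfl hi]
      simp [RSP, Platform.restrict, sum_insert hs]
  exact key P.S P.S_nonempty subset_rfl

lemma compositionAxiom_of_eq_RSP {R : Platform → ℕ → ℝ}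
    (h : ∀ P : Platform, ∀ i ∈ P.N, R P i = RSP P i) : CompositionAxiom R := by
  intro P P' Q hN' hN hdisj hS hp hp' hC hC' i hi
  rw [h P i hi, h P' i (hN' ▸ hi), h Q i (hN ▸ hi), RSP, RSP, RSP, hS, sum_union hdisj, hN, hN']
  congr 1
  · refine sum_congr rfl fun s hs => ?_
    rw [hp s hs, hC i hi s hs, sum_congr rfl fun j hj => hC j hj s hs]
  · refine sum_congr rfl fun s hs => ?_
    rw [hp' s hs, hC' i hi s hs, sum_congr rfl fun j hj => hC' j hj s hs]

lemma nonManipulability_of_eq_RSP {R : Platform → ℕ → ℝ}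
    (h : ∀ P : Platform, ∀ i ∈ P.N, R P i = RSP P i) : NonManipulability R := by
  intro P Q T hT _ i hi hN hS hp hCi hC
  rw [h Q i (by simp [hN]), sum_congr rfl fun j hj => h P j (hT hj)]
  unfold RSP
  rw [sum_comm, hS]
  refine sum_congr rfl fun s hs => ?_
  have htot : ∑ j ∈ Q.N, Q.C j s = ∑ j ∈ P.N, P.C j s := by
    rw [hN, sum_insert (by simp [hi]), hCi s hs, sum_congr rfl fun j hj => hC j hj s hs,
      add_comm, sum_sdiff hT]
  rw [htot, hCi s hs, hp s hs, sum_div, sum_mul]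

/-- An indicator satisfies composition and non-manipulability if and only if it is the
subscriber-proportional indicator. -/
theorem subscriberProportional_characterization (R : Platform → ℕ → ℝ) (hR : IsIndicator R) :
    (CompositionAxiom R ∧ NonManipulability R) ↔ (∀ P : Platform, ∀ i ∈ P.N, R P i = RSP P i) :=
  ⟨fun h P _ hi => eq_RSP_of_composition_of_nonManipulability hR h.1 h.2 P hi,
    fun h => ⟨compositionAxiom_of_eq_RSP h, nonManipulability_of_eq_RSP h⟩⟩
end

section
/- An indicator R satisfies symmetry, homogeneity, and consumption sensitivity if and only if R is the uniform indicator, i.e., R_i(N,S,p,C) = σ/|N| for every platform (N,S,p,C) and every i ∈ N. -/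
open Finset

/-- The platform `P` with its consumption matrix multiplied by `c > 0`. -/
def Platform.scale (P : Platform) (c : ℝ) (hc : 0 < c) : Platform where
  N := P.N
  S := P.S
  p := P.p
  C i s := c * P.C i s
  card_N := P.card_N
  S_nonempty := P.S_nonempty
  p_pos := P.p_pos
  C_nonneg i s := mul_nonneg hc.le (P.C_nonneg i s)
  col_pos s hs := by
    rw [← mul_sum]
    exact mul_pos hc (P.col_pos s hs)

/-- The platform `P` with every entry of its consumption matrix replaced by `1`. -/
def Platform.flat (P : Platform) : Platform where
  N := P.N
  S := P.S
  p := P.p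
  C _ _ := 1
  card_N := P.card_N
  S_nonempty := P.S_nonempty
  p_pos := P.p_pos
  C_nonneg _ _ := zero_le_one
  col_pos s _ := by
    have := P.card_N
    simpa [Finset.card_pos] using card_pos.mp (by omega : 0 < P.N.card)

theorem Homogeneity.scale_eq {R : Platform → ℕ → ℝ} (h : Homogeneity R) (P : Platform)
    (c : ℝ) (hc : 0 < c) {i : ℕ} (hi : i ∈ P.N) : R (P.scale c hc) i = R P i :=
  h P (P.scale c hc) c hc rfl rfl (fun _ _ => rfl) (fun _ _ _ _ => rfl) i hi

/-- Under homogeneity and consumption sensitivity the indicator ignores the consumption matrix: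
any two matrices become arbitrarily close after scaling both down. -/
theorem eq_flat {R : Platform → ℕ → ℝ} (hh : Homogeneity R) (hs : ConsumptionSensitivity R)
    (P : Platform) {i : ℕ} (hi : i ∈ P.N) : R P i = R P.flat i := by
  have hpos (n : ℕ) : (0 : ℝ) < 1 / ((n : ℝ) + 1) := Nat.one_div_pos_of_nat
  have hlim := hs (fun n => P.scale _ (hpos n)) (fun n => P.flat.scale _ (hpos n)) P.N P.S P.p
    (fun _ => rfl) (fun _ => rfl) (fun _ => rfl) (fun _ => rfl) (fun _ _ _ => rfl)
    (fun _ _ _ => rfl) (by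
      have hsum (n : ℕ) : ∑ i ∈ P.N, ∑ s ∈ P.S,
          |(P.scale _ (hpos n)).C i s - (P.flat.scale _ (hpos n)).C i s| =
          1 / ((n : ℝ) + 1) * ∑ i ∈ P.N, ∑ s ∈ P.S, |P.C i s - P.flat.C i s| := by
        simp only [mul_sum, Platform.scale, ← mul_sub, abs_mul, abs_of_pos (hpos n)]
      simp only [hsum]
      simpa using (tendsto_one_div_add_atTop_nhds_zero_nat (𝕜 := ℝ)).mul_const
        (∑ i ∈ P.N, ∑ s ∈ P.S, |P.C i s - P.flat.C i s|))
  have hconst (n : ℕ) :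
      ∑ i ∈ P.N, |R (P.scale _ (hpos n)) i - R (P.flat.scale _ (hpos n)) i| =
        ∑ i ∈ P.N, |R P i - R P.flat i| :=
    sum_congr rfl fun j hj => by
      rw [hh.scale_eq P _ (hpos n) hj, hh.scale_eq P.flat _ (hpos n) hj]
  simp only [hconst] at hlim
  have hzero := tendsto_nhds_unique tendsto_const_nhds hlim
  rw [sum_eq_zero_iff_of_nonneg fun _ _ => abs_nonneg _] at hzero
  exact sub_eq_zero.mp (abs_eq_zero.mp (hzero i hi))

theorem Symmetry.flat_eq_RU {R : Platform → ℕ → ℝ} (h : Symmetry R) (hR : IsIndicator R)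
    (P : Platform) {i : ℕ} (hi : i ∈ P.N) : R P.flat i = RU P i := by
  have hsum : ∑ j ∈ P.N, R P.flat j = success P := (hR P.flat).2
  rw [sum_congr rfl fun j (hj : j ∈ P.N) => h P.flat j hj i hi fun _ _ => rfl, sum_const,
    nsmul_eq_mul] at hsum
  have hcard : (P.N.card : ℝ) ≠ 0 := by
    have := P.card_N
    exact_mod_cast (by omega : P.N.card ≠ 0)
  rw [RU, eq_div_iff hcard, mul_comm, hsum]

/-- An indicator satisfies symmetry, homogeneity, and consumption sensitivity if and only if
it is the uniform indicator. -/
theorem uniform_characterization (R : Platform → ℕ → ℝ) (hR : IsIndicator R) :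
    (Symmetry R ∧ Homogeneity R ∧ ConsumptionSensitivity R) ↔
      (∀ P : Platform, ∀ i ∈ P.N, R P i = RU P i) := by
  constructor
  · rintro ⟨hsym, hhom, hsens⟩ P i hi
    rw [eq_flat hhom hsens P hi, hsym.flat_eq_RU hR P hi]
  · intro h
    refine ⟨fun P i hi j hj _ => ?_, fun P Q lam _ hN hS hp _ i hi => ?_,
      fun P Q N S p hPN hQN hPS hQS hPp hQp _ => ?_⟩
    · rw [h P i hi, h P j hj, RU, RU]
    · rw [h P i hi, h Q i (hN ▸ hi), RU, RU, success, success, hN, hS, sum_congr rfl hp]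
    · have hzero (n : ℕ) : ∑ i ∈ N, |R (P n) i - R (Q n) i| = 0 := by
        refine sum_eq_zero fun i hi => ?_
        rw [h (P n) i (hPN n ▸ hi), h (Q n) i (hQN n ▸ hi), RU, RU, success, success, hPN, hQN,
          hPS, hQS, sum_congr rfl (hPp n), sum_congr rfl (hQp n), sub_self, abs_zero]
      simp only [hzero]
      exact tendsto_const_nhds
end

section
/- Let (N,S,p,C) be a platform and i ∈ N a service such that for every s ∈ S with i ∈ N_s and |N_s| ≥ 2 one has C_{is} ≥ (Σ_{j∈N_s∖{i}} C_{js})/(|N_s| − 1), where N_s = {j ∈ N : C_{js} > 0}. Then R^SP_i(N,S,p,C) ≥ R^SU_i(N,S,p,C). -/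
open Finset

/-- Summing a subscriber's consumption over the services consumed gives the total. -/
theorem sum_Ns (P : Platform) (s : ℕ) : ∑ j ∈ Ns P s, P.C j s = ∑ j ∈ P.N, P.C j s := by
  refine Finset.sum_subset (Finset.filter_subset _ _) fun j hj hn => ?_
  have hle : ¬ 0 < P.C j s := fun hpos => hn (Finset.mem_filter.mpr ⟨hj, hpos⟩)
  exact le_antisymm (not_lt.mp hle) (P.C_nonneg j s)

/-- If an entry is at least the average of the other entries, it is at least the average of
all entries. -/
theorem sum_le_card_mul_of_average_others_le {ι : Type*} [DecidableEq ι] {A : Finset ι}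
    {f : ι → ℝ} {i : ι} (hi : i ∈ A)
    (h : 2 ≤ A.card → (∑ j ∈ A \ {i}, f j) / ((A.card : ℝ) - 1) ≤ f i) :
    ∑ j ∈ A, f j ≤ f i * A.card := by
  have hsum : ∑ j ∈ A \ {i}, f j + f i = ∑ j ∈ A, f j := by
    simpa using Finset.sum_sdiff (f := f) (Finset.singleton_subset_iff.mpr hi)
  by_cases hc : 2 ≤ A.card
  · have hcard : (2 : ℝ) ≤ A.card := by exact_mod_cast hc
    have hle := (div_le_iff₀ (by linarith)).mp (h hc)
    linarith
  · have hcard : A.card = 1 := by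
      have := Finset.card_pos.mpr ⟨i, hi⟩
      omega
    obtain ⟨a, rfl⟩ := Finset.card_eq_one.mp hcard
    simp [Finset.mem_singleton.mp hi]

/-- A service watched by each of its subscribers more than the average of the other services
that subscriber watches prefers the subscriber-proportional indicator over the
subscriber-uniform indicator. -/
theorem RSP_ge_RSU_of_above_average (P : Platform) (i : ℕ) (hi : i ∈ P.N)
    (h : ∀ s ∈ P.S, i ∈ Ns P s → 2 ≤ (Ns P s).card →
        P.C i s ≥ (∑ j ∈ Ns P s \ {i}, P.C j s) / (((Ns P s).card : ℝ) - 1)) :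
    RSP P i ≥ RSU P i := by
  rw [RSP, RSU, Finset.sum_filter]
  refine Finset.sum_le_sum fun s hs => ?_
  have hp := P.p_pos s hs
  have htotal := P.col_pos s hs
  split_ifs with hmem
  · have hcard : (0 : ℝ) < (Ns P s).card := by
      exact_mod_cast Finset.card_pos.mpr ⟨i, hmem⟩
    have hle := sum_le_card_mul_of_average_others_le hmem (h s hs hmem)
    rw [sum_Ns] at hle
    rw [div_mul_eq_mul_div, div_le_div_iff₀ hcard htotal]
    nlinarith
  · exact mul_nonneg (div_nonneg (P.C_nonneg i s) htotal.le) hp.le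
end

section
/- Let (N,S,p,C) and (N',S,p,C') be platforms with the same subscribers S and prices p, let i ∈ N, and suppose N' = (N∖{i}) ∪ {i'_1,…,i'_m} with m ≥ 2 and the i'_l new (not in N), C_{is} = Σ_{l=1}^m C'_{i'_l s} for all s ∈ S, and C_{js} = C'_{js} for all j ∈ N∖{i} and s ∈ S. Then Σ_{l=1}^m R^U_{i'_l}(N',S,p,C') ≥ R^U_i(N,S,p,C) and Σ_{l=1}^m R^SU_{i'_l}(N',S,p,C') ≥ R^SU_i(N,S,p,C). -/
open Finset

theorem div_le_mul_div_of_add_one_eq {n t k : ℕ} (hn : 1 ≤ n) (ht : 1 ≤ t) (hk : k + 1 = n + t)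
    {x : ℝ} (hx : 0 ≤ x) : x / n ≤ t * (x / k) := by
  have hn' : (1 : ℝ) ≤ n := by exact_mod_cast hn
  have ht' : (1 : ℝ) ≤ t := by exact_mod_cast ht
  have hk' : (k : ℝ) + 1 = n + t := by exact_mod_cast hk
  rw [← mul_div_assoc, div_le_div_iff₀ (by linarith) (by linarith)]
  nlinarith [mul_nonneg hx (mul_nonneg (sub_nonneg.2 hn') (sub_nonneg.2 ht'))]

theorem Finset.card_sdiff_singleton_union_add_one {α : Type*} [DecidableEq α] {A B : Finset α}
    {a : α} (ha : a ∈ A) (hBA : Disjoint B A) :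
    ((A \ {a}) ∪ B).card + 1 = A.card + B.card := by
  rw [card_union_of_disjoint (hBA.symm.mono_left sdiff_subset), sdiff_singleton_eq_erase,
    ← card_erase_add_one ha]
  omega

theorem sum_RSU (P : Platform) {T : Finset ℕ} (hT : T ⊆ P.N) :
    ∑ l ∈ T, RSU P l =
      ∑ s ∈ P.S, ((T.filter fun l => 0 < P.C l s).card : ℝ) * (P.p s / ((Ns P s).card : ℝ)) := by
  simp only [RSU, sum_filter]
  rw [sum_comm]
  refine sum_congr rfl fun s _ => ?_
  rw [← sum_filter, sum_const, nsmul_eq_mul]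
  congr 3
  refine filter_congr fun l hl => ?_
  simp [Ns, hT hl]

/-- Splitting a service `i` into `m ≥ 2` new services, distributing its viewing times,
increases the total relevance under the uniform and subscriber-uniform indicators. -/
theorem split_increases_RU_and_RSU (P P' : Platform) (i : ℕ) (hi : i ∈ P.N)
    (T : Finset ℕ) (hm : 2 ≤ T.card) (hnew : Disjoint T P.N)
    (hN' : P'.N = (P.N \ {i}) ∪ T)
    (hS : P'.S = P.S)
    (hp : ∀ s ∈ P.S, P'.p s = P.p s)
    (hsplit : ∀ s ∈ P.S, P.C i s = ∑ l ∈ T, P'.C l s)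
    (hsame : ∀ j ∈ P.N \ {i}, ∀ s ∈ P.S, P.C j s = P'.C j s) :
    (∑ l ∈ T, RU P' l ≥ RU P i) ∧ (∑ l ∈ T, RSU P' l ≥ RSU P i) := by
  have hx : ∀ s ∈ P.S, 0 ≤ P.p s := fun s hs => (P.p_pos s hs).le
  constructor
  · have hsucc : success P' = success P := by
      rw [success, success, hS]
      exact sum_congr rfl hp
    simp only [RU, sum_const, nsmul_eq_mul, hsucc, hN']
    exact div_le_mul_div_of_add_one_eq (card_pos.2 ⟨i, hi⟩) (by omega)
      (card_sdiff_singleton_union_add_one hi hnew) (sum_nonneg hx)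
  · rw [sum_RSU P' (hN' ▸ subset_union_right), hS, RSU, sum_filter]
    refine sum_le_sum fun s hs => ?_
    rw [hp s hs]
    split_ifs with his
    · have hNs : Ns P' s = (Ns P s \ {i}) ∪ T.filter fun l => 0 < P'.C l s := by
        ext j
        have := hsame j
        simp only [Ns, hN', mem_filter, mem_union, mem_sdiff, mem_singleton] at this ⊢
        grind
      have hT : (T.filter fun l => 0 < P'.C l s).Nonempty := by
        have hpos : 0 < ∑ l ∈ T, P'.C l s := hsplit s hs ▸ (mem_filter.1 his).2
        obtain ⟨l, hl, hlpos⟩ := exists_lt_of_sum_lt (s := T) (f := fun _ => (0 : ℝ))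
          (g := fun l => P'.C l s) (by simpa using hpos)
        exact ⟨l, mem_filter.2 ⟨hl, hlpos⟩⟩
      rw [hNs]
      exact div_le_mul_div_of_add_one_eq (card_pos.2 ⟨i, his⟩) (card_pos.2 hT)
        (card_sdiff_singleton_union_add_one his
          (hnew.mono (filter_subset _ _) (filter_subset _ _))) (hx s hs)
    · have := hx s hs
      positivity
end

section
/- The subscriber-proportional indicator satisfies non-manipulability: for every platform (N,S,p,C), every nonempty N' ⊆ N and every i ∈ N', letting C' be the matrix on services ({i} ∪ N∖N') × S with C'_{is} = Σ_{j∈N'} C_{js} for all s ∈ S and C'_{js} = C_{js} for j ∈ N∖N', one has R^SP_i({i} ∪ N∖N', S, p, C') = Σ_{j∈N'} R^SP_j(N,S,p,C). -/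
open Finset

/-- The subscriber-proportional indicator satisfies non-manipulability. -/
theorem RSP_nonManipulability : NonManipulability RSP := by
  intro P Q N' hN' _ i hi hQN hQS hp hCi hC
  have hcol : ∀ s ∈ P.S, ∑ j ∈ Q.N, Q.C j s = ∑ j ∈ P.N, P.C j s := by
    intro s hs
    have hnot : i ∉ P.N \ N' := fun h => (mem_sdiff.mp h).2 hi
    rw [hQN, sum_insert hnot, hCi s hs, sum_congr rfl fun j hj => hC j hj s hs, add_comm,
      sum_sdiff hN']
  unfold RSP
  rw [sum_comm, hQS]
  refine sum_congr rfl fun s hs => ?_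
  rw [hcol s hs, hp s hs, hCi s hs, sum_div, sum_mul]
end

section
/- The proportional indicator satisfies sharing proofness: for every platform (N,S,p,C), every nonempty S' ⊆ S and every s ∈ S', letting p' be the price vector on {s} ∪ S∖S' with p'_s = Σ_{t∈S'} p_t and p'_t = p_t for t ∈ S∖S', and C' the matrix on N × ({s} ∪ S∖S') with C'_{is} = Σ_{t∈S'} C_{it} for all i ∈ N and C'_{it} = C_{it} for t ∈ S∖S', one has R^P_i(N, {s} ∪ S∖S', p', C') = R^P_i(N,S,p,C) for every i ∈ N. -/
open Finset

/-- Merging a subset `T` of the index set into one of its members, which carries the total over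
`T`, preserves the sum. -/
theorem sum_insert_sdiff_of_eq_sum {ι M : Type*} [DecidableEq ι] [AddCommMonoid M]
    {S T : Finset ι} (hT : T ⊆ S) {s : ι} (hs : s ∈ T) {f g : ι → M}
    (hgs : g s = ∑ t ∈ T, f t) (hg : ∀ t ∈ S \ T, g t = f t) :
    ∑ t ∈ insert s (S \ T), g t = ∑ t ∈ S, f t := by
  rw [Finset.sum_insert (by simp [hs]), hgs, Finset.sum_congr rfl hg, add_comm,
    Finset.sum_sdiff hT]

/-- The proportional indicator satisfies sharing proofness. -/
theorem RP_sharingProofness : SharingProofness RP := by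
  intro P Q T hT _ s hs hN hS hps hp hCs hC i hi
  have total (j : ℕ) (hj : j ∈ P.N) : ∑ t ∈ Q.S, Q.C j t = ∑ t ∈ P.S, P.C j t := by
    rw [hS]
    exact sum_insert_sdiff_of_eq_sum hT hs (hCs j hj) (hC j hj)
  have hsuccess : success Q = success P := by
    rw [success, success, hS]
    exact sum_insert_sdiff_of_eq_sum hT hs hps hp
  rw [RP, RP, hN, hsuccess, total i hi, Finset.sum_congr rfl total]
end
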